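/- One has dim_k Hom_{kG}(St ⊗_k St, k_tr) = 1, Hom_{kG}(St ⊗_k St, St) = 0, and Hom_{kG}(St ⊗_k St, M(θ)) = 0 for every nontrivial character θ : T → k*. In particular, the maximal semisimple quotient of St ⊗_k St among direct sums of the modules St, k_tr, M(θ) is the trivial module k_tr. -/

import Mathlib

noncomputable section

open scoped TensorProduct

namespace SL2X

variable (p : ℕ) [Fact p.Prime]

/-- The algebraic closure of the prime field `𝔽_p`. -/
abbrev F : Type := AlgebraicClosure (ZMod p)

/-- `G = SL₂(F)`. -/
abbrev G : Type := Matrix.SpecialLinearGroup (Fin 2) (F p)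

/-- The unipotent element `ε(x) = [[1,x],[0,1]]`. -/
def eps (x : F p) : G p :=
  ⟨!![1, x; 0, 1], by simp [Matrix.det_fin_two_of]⟩

/-- The torus element `h(t) = diag(t, t⁻¹)`. -/
def h (t : (F p)ˣ) : G p :=
  ⟨!![(t : F p), 0; 0, ((t⁻¹ : (F p)ˣ) : F p)], by simp [Matrix.det_fin_two_of]⟩

/-- The Weyl element `s = [[0,1],[-1,0]]`. -/
def sG : G p :=
  ⟨!![0, 1; -1, 0], by simp [Matrix.det_fin_two_of]⟩

/-- The Borel subgroup `B` of upper triangular matrices in `G`. -/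
def B : Subgroup (G p) where
  carrier := {g | (g : Matrix (Fin 2) (Fin 2) (F p)) 1 0 = 0}
  one_mem' := by simp [Matrix.one_apply]
  mul_mem' := by
    intro a b ha hb
    simp only [Set.mem_setOf_eq] at *
    simp [Matrix.mul_apply, Fin.sum_univ_two, ha, hb]
  inv_mem' := by
    intro a ha
    simp only [Set.mem_setOf_eq] at *
    simp [Matrix.SpecialLinearGroup.coe_inv, Matrix.adjugate_fin_two, ha]

/-- The diagonal part of an element of `B`, as a unit of `F`. -/
def Bdiag (b : B p) : (F p)ˣ where
  val := ((b : G p) : Matrix (Fin 2) (Fin 2) (F p)) 0 0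
  inv := ((b : G p) : Matrix (Fin 2) (Fin 2) (F p)) 1 1
  val_inv := by
    have hdet : ((b : G p) : Matrix (Fin 2) (Fin 2) (F p)).det = 1 := (b : G p).2
    have h10 : ((b : G p) : Matrix (Fin 2) (Fin 2) (F p)) 1 0 = 0 := b.2
    rw [Matrix.det_fin_two, h10, mul_zero, sub_zero] at hdet
    exact hdet
  inv_val := by
    have hdet : ((b : G p) : Matrix (Fin 2) (Fin 2) (F p)).det = 1 := (b : G p).2
    have h10 : ((b : G p) : Matrix (Fin 2) (Fin 2) (F p)) 1 0 = 0 := b.2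
    rw [Matrix.det_fin_two, h10, mul_zero, sub_zero] at hdet
    rw [mul_comm]; exact hdet

variable (k : Type) [Field k] [IsAlgClosed k] [CharZero k]

/-- The group algebra `kG`. -/
abbrev kG : Type := MonoidAlgebra k (G p)

/-- The canonical image of a group element in the group algebra. -/
def γ (g : G p) : kG p k := MonoidAlgebra.of k (G p) g

/-- The submodule of relations defining the induced module
`M(θ) = kG ⊗_{kB} k_θ`, where the character `θ` of `T ≅ Fˣ` is extended to `B`
by letting `U` act trivially. -/
def Nmod (θ : (F p)ˣ →* kˣ) : Submodule (kG p k) (kG p k) :=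
  Submodule.span (kG p k)
    {y | ∃ b : B p, y = γ p k (b : G p) - ((θ (Bdiag p b) : k)) • (1 : kG p k)}

/-- The induced module `M(θ) = kG ⊗_{kB} k_θ`, realized as `kG / N(θ)` where
`N(θ)` is the left submodule generated by the elements `b - θ(b)·1`, `b ∈ B`. -/
def Mmod (θ : (F p)ˣ →* kˣ) : Type := kG p k ⧸ Nmod p k θ

instance (θ : (F p)ˣ →* kˣ) : AddCommGroup (Mmod p k θ) :=
  inferInstanceAs (AddCommGroup (kG p k ⧸ Nmod p k θ))
instance (θ : (F p)ˣ →* kˣ) : Module (kG p k) (Mmod p k θ) :=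
  inferInstanceAs (Module (kG p k) (kG p k ⧸ Nmod p k θ))
instance (θ : (F p)ˣ →* kˣ) : Module k (Mmod p k θ) :=
  inferInstanceAs (Module k (kG p k ⧸ Nmod p k θ))
instance (θ : (F p)ˣ →* kˣ) : IsScalarTower k (kG p k) (Mmod p k θ) :=
  inferInstanceAs (IsScalarTower k (kG p k) (kG p k ⧸ Nmod p k θ))

/-- The canonical generator `1_θ ∈ M(θ)`. -/
def oneθ (θ : (F p)ˣ →* kˣ) : Mmod p k θ :=
  Submodule.Quotient.mk (1 : kG p k)

/-- `η = (1 - s)·1_tr ∈ M(tr)`. -/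
def eta : Mmod p k 1 :=
  Submodule.Quotient.mk ((1 : kG p k) - γ p k (sG p))

/-- The Steinberg module `St = kG·η ⊆ M(tr)`. -/
def St : Submodule (kG p k) (Mmod p k 1) :=
  Submodule.span (kG p k) {eta p k}

/-- `ε(x)·η` as an element of `St`. -/
def E (x : F p) : ↥(St p k) :=
  ⟨γ p k (eps p x) • eta p k,
    Submodule.smul_mem _ _ (Submodule.mem_span_singleton_self _)⟩

/-- The action of a group element on `St`, as a `k`-linear map. -/
def gSt (g : G p) : ↥(St p k) →ₗ[k] ↥(St p k) where
  toFun v := ⟨γ p k g • (v : Mmod p k 1), Submodule.smul_mem _ _ v.2⟩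
  map_add' := by intro a b; apply Subtype.ext; simp [smul_add]
  map_smul' := by
    intro c v; apply Subtype.ext
    simp [smul_comm (γ p k g) c]

/-- `St ⊗_k St`. -/
abbrev StT : Type := ↥(St p k) ⊗[k] ↥(St p k)

/-- The diagonal action of a group element on `St ⊗_k St`. -/
def gTT (g : G p) : StT p k →ₗ[k] StT p k :=
  TensorProduct.map (gSt p k g) (gSt p k g)

/-- `ω_{x,y} = (ε(x)η ⊗ ε(y)η + ε(y)η ⊗ ε(x)η)/2`. -/
def ω (x y : F p) : StT p k :=
  (2 : k)⁻¹ • (E p k x ⊗ₜ[k] E p k y + E p k y ⊗ₜ[k] E p k x)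

/-- `ρ_{x,y} = (ε(x)η ⊗ ε(y)η − ε(y)η ⊗ ε(x)η)/2`. -/
def ρ (x y : F p) : StT p k :=
  (2 : k)⁻¹ • (E p k x ⊗ₜ[k] E p k y - E p k y ⊗ₜ[k] E p k x)

/-- `V₊`, the span of the `ω_{x,y}`. -/
def Vplus : Submodule k (StT p k) :=
  Submodule.span k {v | ∃ x y : F p, v = ω p k x y}

/-- `V₋`, the span of the `ρ_{x,y}` for `x ≠ y`. -/
def Vminus : Submodule k (StT p k) :=
  Submodule.span k {v | ∃ x y : F p, x ≠ y ∧ v = ρ p k x y}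


section Auxiliary

set_option linter.unusedSectionVars false

variable {p k}

lemma coe_eps (x : F p) : (eps p x : Matrix (Fin 2) (Fin 2) (F p)) = !![1, x; 0, 1] := rfl

lemma coe_h (t : (F p)ˣ) :
    (h p t : Matrix (Fin 2) (Fin 2) (F p)) = !![(t : F p), 0; 0, ((t⁻¹ : (F p)ˣ) : F p)] := rfl

lemma coe_sG : (sG p : Matrix (Fin 2) (Fin 2) (F p)) = !![0, 1; -1, 0] := rfl

lemma gamma_mul (g g' : G p) : γ p k (g * g') = γ p k g * γ p k g' :=
  map_mul (MonoidAlgebra.of k (G p)) g g'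

lemma gamma_one : γ p k 1 = 1 := map_one (MonoidAlgebra.of k (G p))

lemma mem_B_iff {g : G p} : g ∈ B p ↔ (g : Matrix (Fin 2) (Fin 2) (F p)) 1 0 = 0 := Iff.rfl

/-- Two linear maps on `kG` agreeing on group elements are equal. -/
lemma kG_hom_ext {V : Type*} [AddCommGroup V] [Module k V] {f f' : kG p k →ₗ[k] V}
    (H : ∀ g, f (γ p k g) = f' (γ p k g)) : f = f' := by
  refine (MonoidAlgebra.basis (G p) k).ext fun g => ?_
  rw [MonoidAlgebra.basis_apply]
  exact H g

section Induced

variable {θ : (F p)ˣ →* kˣ} {V : Type*} [AddCommGroup V] [Module k V]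

lemma gamma_smul_oneθ_eq (g : G p) :
    γ p k g • oneθ p k θ = (Submodule.Quotient.mk (γ p k g) : kG p k ⧸ Nmod p k θ) := by
  change (Submodule.Quotient.mk (γ p k g • (1 : kG p k)) : kG p k ⧸ Nmod p k θ) = _
  rw [smul_eq_mul, mul_one]

lemma gamma_mul_smul_oneθ (g : G p) (b : B p) :
    γ p k (g * b) • oneθ p k θ = (θ (Bdiag p b) : k) • γ p k g • oneθ p k θ := by
  rw [gamma_mul, mul_smul, smul_comm (θ (Bdiag p b) : k) (γ p k g)]
  congr 1
  change (Submodule.Quotient.mk (γ p k b • (1 : kG p k)) : kG p k ⧸ Nmod p k θ) =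
    Submodule.Quotient.mk ((θ (Bdiag p b) : k) • (1 : kG p k))
  rw [smul_eq_mul, mul_one, Submodule.Quotient.eq]
  exact Submodule.subset_span ⟨b, rfl⟩

/-- Two linear maps on `M(θ)` agreeing on the translates of `1_θ` are equal. -/
lemma Mmod_hom_ext {f f' : Mmod p k θ →ₗ[k] V}
    (H : ∀ g, f (γ p k g • oneθ p k θ) = f' (γ p k g • oneθ p k θ)) : f = f' := by
  let π : kG p k →ₗ[k] Mmod p k θ :=
    (LinearMap.toSpanSingleton (kG p k) _ (oneθ p k θ)).restrictScalars k
  have hπ : f ∘ₗ π = f' ∘ₗ π := kG_hom_ext fun g => H g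
  ext m
  obtain ⟨a, rfl⟩ := Submodule.Quotient.mk_surjective (Nmod p k θ) m
  have ha : (Submodule.Quotient.mk a : kG p k ⧸ Nmod p k θ) = π a := by
    change _ = (Submodule.Quotient.mk (a • (1 : kG p k)) : kG p k ⧸ Nmod p k θ)
    rw [smul_eq_mul, mul_one]
  rw [ha]
  exact LinearMap.congr_fun hπ a

/-- The linear map on `M(θ)` given by a `θ`-equivariant function on the group. -/
def liftM (f : G p → V) (hf : ∀ (g : G p) (b : B p), f (g * b) = (θ (Bdiag p b) : k) • f g) :
    Mmod p k θ →ₗ[k] V :=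
  (Submodule.liftQ ((Nmod p k θ).restrictScalars k)
    ((MonoidAlgebra.basis (G p) k).constr k f) (by
      have hγ : ∀ g, (MonoidAlgebra.basis (G p) k).constr k f (γ p k g) = f g := fun g => by
        have := (MonoidAlgebra.basis (G p) k).constr_basis k f g
        rwa [MonoidAlgebra.basis_apply] at this
      set Φ := (MonoidAlgebra.basis (G p) k).constr k f
      intro y hy
      suffices ∀ a : kG p k, Φ (a * y) = 0 by
        simpa using this 1
      rw [Submodule.restrictScalars_mem] at hy
      induction hy using Submodule.span_induction with
      | mem y hy =>
        obtain ⟨b, rfl⟩ := hy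
        intro a
        have : Φ ∘ₗ LinearMap.mulRight k
            (γ p k (b : G p) - ((θ (Bdiag p b) : k)) • (1 : kG p k)) = 0 :=
          kG_hom_ext fun g => by
            simp only [LinearMap.comp_apply, LinearMap.mulRight_apply, LinearMap.zero_apply]
            rw [mul_sub, map_sub, ← gamma_mul, hγ, hf, mul_smul_comm, mul_one, map_smul, hγ,
              sub_self]
        exact LinearMap.congr_fun this a
      | zero => simp
      | add x y _ _ hx hy => intro a; rw [mul_add, map_add, hx, hy, add_zero]
      | smul c x _ hx => intro a; rw [smul_eq_mul, ← mul_assoc]; exact hx _)) ∘ₗ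
  ((Submodule.Quotient.restrictScalarsEquiv k (Nmod p k θ)).symm.toLinearMap)

lemma liftM_apply (f : G p → V) (hf) (g : G p) :
    liftM (θ := θ) f hf (γ p k g • oneθ p k θ) = f g := by
  rw [gamma_smul_oneθ_eq]
  have := (MonoidAlgebra.basis (G p) k).constr_basis k f g
  rw [MonoidAlgebra.basis_apply] at this
  exact this

open Classical in
/-- The coefficient at `1_θ`, i.e. at the base point of `G / B`. -/
def ell (θ : (F p)ˣ →* kˣ) : Mmod p k θ →ₗ[k] k :=
  liftM (fun g => if hg : g ∈ B p then (θ (Bdiag p ⟨g, hg⟩) : k) else 0) (by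
    intro g b
    by_cases hg : g ∈ B p
    · have hgb : g * b ∈ B p := mul_mem hg b.2
      rw [dif_pos hg, dif_pos hgb, smul_eq_mul, ← Units.val_mul, ← map_mul]
      congr 2
      ext
      have hb : ((b : G p) : Matrix (Fin 2) (Fin 2) (F p)) 1 0 = 0 := b.2
      simp [Bdiag, Matrix.mul_apply, Fin.sum_univ_two, hb, mul_comm]
    · have hgb : g * b ∉ B p := fun H => hg ((Subgroup.mul_mem_cancel_right _ b.2).1 H)
      rw [dif_neg hg, dif_neg hgb, smul_zero])

lemma ell_of_mem (b : B p) : ell θ (γ p k b • oneθ p k θ) = θ (Bdiag p b) := by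
  rw [ell, liftM_apply, dif_pos b.2]

lemma ell_of_notMem {g : G p} (hg : g ∉ B p) : ell θ (γ p k g • oneθ p k θ) = 0 := by
  rw [ell, liftM_apply, dif_neg hg]

lemma Bdiag_mul (b c : B p) : Bdiag p (b * c) = Bdiag p b * Bdiag p c := by
  ext
  have hc : ((c : G p) : Matrix (Fin 2) (Fin 2) (F p)) 1 0 = 0 := c.2
  simp [Bdiag, Matrix.mul_apply, Fin.sum_univ_two, hc]

lemma ell_smul (b : B p) (m : Mmod p k θ) :
    ell θ (γ p k b • m) = θ (Bdiag p b) * ell θ m := by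
  have : ell θ ∘ₗ Algebra.lsmul k k (Mmod p k θ) (γ p k (b : G p)) =
      (θ (Bdiag p b) : k) • ell θ := Mmod_hom_ext fun g => by
    simp only [LinearMap.comp_apply, LinearMap.smul_apply, Algebra.lsmul_coe, smul_eq_mul]
    rw [← mul_smul, ← gamma_mul]
    by_cases hg : g ∈ B p
    · have hbg := ell_of_mem (θ := θ) (b * ⟨g, hg⟩)
      rw [Subgroup.coe_mul] at hbg
      rw [hbg, Bdiag_mul, map_mul, Units.val_mul, ell_of_mem ⟨g, hg⟩]
    · have hgb : b * g ∉ B p := fun H => hg ((Subgroup.mul_mem_cancel_left _ b.2).1 H)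
      rw [ell_of_notMem hg, ell_of_notMem hgb, mul_zero]
  exact LinearMap.congr_fun this m

lemma eps_mem (x : F p) : eps p x ∈ B p := by simp [mem_B_iff, coe_eps]

lemma h_mem (t : (F p)ˣ) : h p t ∈ B p := by simp [mem_B_iff, coe_h]

lemma sG_notMem : sG p ∉ B p := by simp [mem_B_iff, coe_sG]

lemma Bdiag_eps (x : F p) : Bdiag p ⟨eps p x, eps_mem x⟩ = 1 := by
  ext; simp [Bdiag, coe_eps]

lemma Bdiag_h (t : (F p)ˣ) : Bdiag p ⟨h p t, h_mem t⟩ = t := by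
  ext; simp [Bdiag, coe_h]

lemma ell_eps (x : F p) (m : Mmod p k θ) : ell θ (γ p k (eps p x) • m) = ell θ m := by
  rw [ell_smul ⟨_, eps_mem x⟩, Bdiag_eps, map_one, Units.val_one, one_mul]

lemma ell_h (t : (F p)ˣ) (m : Mmod p k θ) :
    ell θ (γ p k (h p t) • m) = θ t * ell θ m := by
  rw [ell_smul ⟨_, h_mem t⟩, Bdiag_h]

lemma ell_oneθ : ell θ (oneθ p k θ) = 1 := by
  have := ell_eps (θ := θ) 0 (oneθ p k θ)
  rw [← this, ell_of_mem ⟨_, eps_mem 0⟩, Bdiag_eps, map_one, Units.val_one]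

lemma eps_mul (x y : F p) : eps p x * eps p y = eps p (x + y) := by
  ext i j; fin_cases i <;> fin_cases j <;> simp [coe_eps, add_comm]

lemma eps_zero : eps p 0 = 1 := by
  ext i j; fin_cases i <;> fin_cases j <;> simp [coe_eps]

/-- Bruhat decomposition: an element outside `B` lies in some `ε(x) s B`. -/
lemma exists_eq_eps_sG_mul {g : G p} (hg : g ∉ B p) :
    ∃ b : B p, g = eps p ((g : Matrix (Fin 2) (Fin 2) (F p)) 0 0 /
      (g : Matrix (Fin 2) (Fin 2) (F p)) 1 0) * sG p * b := by
  rw [mem_B_iff] at hg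
  set x := (g : Matrix (Fin 2) (Fin 2) (F p)) 0 0 / (g : Matrix (Fin 2) (Fin 2) (F p)) 1 0
  refine ⟨⟨(eps p x * sG p)⁻¹ * g, ?_⟩, by group⟩
  rw [mem_B_iff, mul_inv_rev]
  simp [Matrix.SpecialLinearGroup.coe_inv, Matrix.adjugate_fin_two, coe_eps, coe_sG,
    Matrix.mul_apply, Fin.sum_univ_two, x, hg]

/-- Elements of `M(θ)` expanded in the basis `1_θ`, `ε(x)s 1_θ`. -/
lemma exists_expansion (m : Mmod p k θ) : ∃ (a : k) (c : F p →₀ k),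
    m = a • oneθ p k θ + c.sum fun x r => r • γ p k (eps p x * sG p) • oneθ p k θ := by
  let Φ : k × (F p →₀ k) →ₗ[k] Mmod p k θ :=
    (LinearMap.toSpanSingleton k _ (oneθ p k θ)).coprod
      (Finsupp.linearCombination k fun x => γ p k (eps p x * sG p) • oneθ p k θ)
  have key : ∀ g, γ p k g • oneθ p k θ ∈ LinearMap.range Φ := by
    intro g
    by_cases hg : g ∈ B p
    · refine ⟨(θ (Bdiag p ⟨g, hg⟩), 0), ?_⟩
      have := gamma_mul_smul_oneθ (θ := θ) 1 ⟨g, hg⟩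
      rw [one_mul, gamma_one, one_smul] at this
      simp [Φ, this]
    · obtain ⟨b, hb⟩ := exists_eq_eps_sG_mul hg
      refine ⟨(0, Finsupp.single ((g : Matrix (Fin 2) (Fin 2) (F p)) 0 0 /
        (g : Matrix (Fin 2) (Fin 2) (F p)) 1 0) (θ (Bdiag p b))), ?_⟩
      conv_rhs => rw [hb, gamma_mul_smul_oneθ]
      simp [Φ]
  have hq : (LinearMap.range Φ).mkQ = 0 := Mmod_hom_ext fun g => by
    simpa using key g
  have hm : m ∈ LinearMap.range Φ := by
    have := LinearMap.congr_fun hq m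
    simpa using this
  obtain ⟨⟨a, c⟩, rfl⟩ := hm
  exact ⟨a, c, by simp [Φ, Finsupp.linearCombination_apply]⟩

open Classical in
lemma ell_sG_inv_eps (x y : F p) :
    ell θ (γ p k ((sG p)⁻¹ * eps p (-y)) • γ p k (eps p x * sG p) • oneθ p k θ) =
      if x = y then 1 else 0 := by
  rw [← mul_smul, ← gamma_mul, ← mul_assoc, mul_assoc (sG p)⁻¹, eps_mul]
  split_ifs with hxy
  · rw [hxy, neg_add_cancel, eps_zero, mul_one, inv_mul_cancel, gamma_one, one_smul, ell_oneθ]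
  · apply ell_of_notMem
    simpa [mem_B_iff, Matrix.SpecialLinearGroup.coe_inv, Matrix.adjugate_fin_two, coe_eps, coe_sG,
      Matrix.mul_apply, Fin.sum_univ_two, neg_add_eq_zero, eq_comm] using hxy

/-- The coefficients of the expansion in the basis `1_θ`, `ε(x)s 1_θ` are given by `ell`. -/
lemma exists_expansion_ell (m : Mmod p k θ) : ∃ c : F p →₀ k,
    (∀ x, c x = ell θ (γ p k ((sG p)⁻¹ * eps p (-x)) • m)) ∧
    m = ell θ m • oneθ p k θ +
      c.sum fun x r => r • γ p k (eps p x * sG p) • oneθ p k θ := by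
  obtain ⟨a, c, hm⟩ := exists_expansion m
  have hs : ∀ x, eps p x * sG p ∉ B p := by
    intro x; simp [mem_B_iff, coe_eps, coe_sG]
  have hs' : ∀ x, (sG p)⁻¹ * eps p x ∉ B p := by
    intro x
    simp [mem_B_iff, coe_eps, coe_sG, Matrix.SpecialLinearGroup.coe_inv, Matrix.adjugate_fin_two]
  have ha : ell θ m = a := by
    rw [hm]
    simp [map_finsuppSum, ell_of_notMem (hs _), ell_oneθ]
  refine ⟨c, fun y => ?_, by rw [ha]; exact hm⟩
  rw [hm, smul_add, map_add, smul_comm, map_smul, ell_of_notMem (hs' _), smul_zero, zero_add,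
    Finsupp.smul_sum, map_finsuppSum]
  simp only [smul_comm (γ p k ((sG p)⁻¹ * eps p (-y))) (_ : k), map_smul, ell_sG_inv_eps]
  classical
  simp

lemma finite_ell_ne_zero (m : Mmod p k θ) :
    {x | ell θ (γ p k ((sG p)⁻¹ * eps p (-x)) • m) ≠ 0}.Finite := by
  obtain ⟨c, hc, -⟩ := exists_expansion_ell m
  refine c.support.finite_toSet.subset fun x hx => ?_
  simpa [hc] using hx

lemma eq_zero_of_ell_eq_zero {m : Mmod p k θ} (H : ∀ g, ell θ (γ p k g • m) = 0) : m = 0 := by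
  obtain ⟨c, hc, hm⟩ := exists_expansion_ell m
  have hc0 : c = 0 := by ext x; rw [hc, H]; rfl
  have h1 : ell θ m = 0 := by simpa [gamma_one] using H 1
  rw [hm, h1, hc0]; simp

end Induced

section Steinberg

lemma smul_oneθ_of_mem {g : G p} (hg : g ∈ B p) : γ p k g • oneθ p k 1 = oneθ p k 1 := by
  have := gamma_mul_smul_oneθ (k := k) (θ := 1) 1 ⟨g, hg⟩
  simpa [gamma_one] using this

lemma smul_oneθ_eq {g : G p} {x : F p}
    (hg : (g : Matrix (Fin 2) (Fin 2) (F p)) 1 0 ≠ 0)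
    (hx : (g : Matrix (Fin 2) (Fin 2) (F p)) 0 0 / (g : Matrix (Fin 2) (Fin 2) (F p)) 1 0 = x) :
    γ p k g • oneθ p k 1 = γ p k (eps p x * sG p) • oneθ p k 1 := by
  obtain ⟨b, hb⟩ := exists_eq_eps_sG_mul (g := g) hg
  rw [hx] at hb
  rw [hb, gamma_mul_smul_oneθ]
  simp

lemma eta_eq : eta p k = oneθ p k 1 - γ p k (sG p) • oneθ p k 1 := by
  rw [gamma_smul_oneθ_eq]
  rfl

lemma coe_E (x : F p) :
    (E p k x : Mmod p k 1) = oneθ p k 1 - γ p k (eps p x * sG p) • oneθ p k 1 := by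
  change γ p k (eps p x) • eta p k = _
  rw [eta_eq, smul_sub, smul_oneθ_of_mem (eps_mem x), gamma_mul, mul_smul]

lemma coe_gSt_E (g : G p) (x : F p) : (gSt p k g (E p k x) : Mmod p k 1) =
    γ p k g • oneθ p k 1 - γ p k (g * (eps p x * sG p)) • oneθ p k 1 := by
  change γ p k g • (E p k x : Mmod p k 1) = _
  rw [coe_E, smul_sub, gamma_mul g, mul_smul]

lemma gSt_mul (g g' : G p) (v : St p k) : gSt p k (g * g') v = gSt p k g (gSt p k g' v) := by
  apply Subtype.ext
  change γ p k (g * g') • (v : Mmod p k 1) = γ p k g • γ p k g' • (v : Mmod p k 1)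
  rw [gamma_mul, mul_smul]

lemma gSt_eps_E (a x : F p) : gSt p k (eps p a) (E p k x) = E p k (a + x) := by
  apply Subtype.ext
  rw [coe_gSt_E, coe_E, smul_oneθ_of_mem (eps_mem a), ← mul_assoc, eps_mul]

lemma gSt_h_E (t : (F p)ˣ) (x : F p) : gSt p k (h p t) (E p k x) = E p k (t ^ 2 * x) := by
  apply Subtype.ext
  rw [coe_gSt_E, coe_E, smul_oneθ_of_mem (h_mem t)]
  congr 1
  apply smul_oneθ_eq
  · simp [coe_h, coe_eps, coe_sG]
  · simp [coe_h, coe_eps, coe_sG]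
    ring

lemma smul_sG_inv_oneθ :
    γ p k (sG p)⁻¹ • oneθ p k 1 = γ p k (eps p 0 * sG p) • oneθ p k 1 := by
  apply smul_oneθ_eq <;>
    simp [coe_sG, Matrix.SpecialLinearGroup.coe_inv, Matrix.adjugate_fin_two]

lemma gSt_sG_inv_E_zero : gSt p k (sG p)⁻¹ (E p k 0) = (-1 : k) • E p k 0 := by
  apply Subtype.ext
  change _ = (-1 : k) • (E p k 0 : Mmod p k 1)
  rw [neg_smul, one_smul, coe_gSt_E, coe_E, smul_sG_inv_oneθ, eps_zero, one_mul, inv_mul_cancel,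
    gamma_one, one_smul, neg_sub]

lemma gSt_sG_inv_E {x : F p} (hx : x ≠ 0) :
    gSt p k (sG p)⁻¹ (E p k x) = E p k (-x⁻¹) - E p k 0 := by
  apply Subtype.ext
  rw [coe_gSt_E, Submodule.coe_sub, coe_E, coe_E, smul_sG_inv_oneθ,
    smul_oneθ_eq (g := (sG p)⁻¹ * (eps p x * sG p)) (x := -x⁻¹)]
  · abel
  · simpa [coe_sG, coe_eps, Matrix.SpecialLinearGroup.coe_inv, Matrix.adjugate_fin_two,
      Matrix.mul_apply, Fin.sum_univ_two] using hx
  · simp [coe_sG, coe_eps, Matrix.SpecialLinearGroup.coe_inv, Matrix.adjugate_fin_two,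
      Matrix.mul_apply, Fin.sum_univ_two]

lemma gTT_tmul (g : G p) (v w : St p k) :
    gTT p k g (v ⊗ₜ[k] w) = gSt p k g v ⊗ₜ[k] gSt p k g w := rfl

lemma gTT_mul (g g' : G p) (v : StT p k) : gTT p k (g * g') v = gTT p k g (gTT p k g' v) := by
  have : gTT p k (g * g') = gTT p k g ∘ₗ gTT p k g' :=
    TensorProduct.ext' fun v w => by
      simp only [LinearMap.comp_apply, gTT_tmul, gSt_mul]
  exact LinearMap.congr_fun this v

/-- The inclusion of the Steinberg module as a `k`-linear map. -/
def inclSt (p : ℕ) [Fact p.Prime] (k : Type) [Field k] : St p k →ₗ[k] Mmod p k 1 :=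
  (St p k).subtype.restrictScalars k

lemma inclSt_apply (v : St p k) : inclSt p k v = v := rfl

lemma inclSt_injective : Function.Injective (inclSt p k) := Subtype.val_injective

lemma span_E : Submodule.span k (Set.range (E p k)) = ⊤ := by
  set S := (Submodule.span k (Set.range (E p k))).map (inclSt p k)
  have hE : ∀ x, (E p k x : Mmod p k 1) ∈ S := fun x =>
    Submodule.mem_map_of_mem (f := inclSt p k) (Submodule.subset_span (Set.mem_range_self x))
  have hpt : ∀ g, oneθ p k 1 - γ p k g • oneθ p k 1 ∈ S := by
    intro g
    by_cases hg : g ∈ B p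
    · rw [smul_oneθ_of_mem hg, sub_self]
      exact zero_mem _
    · rw [smul_oneθ_eq hg rfl, ← coe_E]
      exact hE _
  have hη : S.mkQ ∘ₗ (LinearMap.toSpanSingleton (kG p k) _ (eta p k)).restrictScalars k = 0 :=
    kG_hom_ext fun g => by
      have : γ p k g • eta p k ∈ S := by
        rw [eta_eq, smul_sub, ← mul_smul, ← gamma_mul]
        convert sub_mem (hpt (g * sG p)) (hpt g) using 1
        abel
      simpa using this
  refine eq_top_iff.2 fun v _ => ?_
  obtain ⟨a, ha⟩ := Submodule.mem_span_singleton.1 v.2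
  have hv : (v : Mmod p k 1) ∈ S := by
    have := LinearMap.congr_fun hη a
    rw [← ha]
    simpa using this
  obtain ⟨w, hw, hwv⟩ := hv
  rwa [← inclSt_injective hwv]

lemma StT_hom_ext {V : Type*} [AddCommGroup V] [Module k V] {f f' : StT p k →ₗ[k] V}
    (H : ∀ x y, f (E p k x ⊗ₜ[k] E p k y) = f' (E p k x ⊗ₜ[k] E p k y)) : f = f' :=
  TensorProduct.ext <| LinearMap.ext_on_range span_E fun x =>
    LinearMap.ext_on_range span_E fun y => H x y

/-- The augmentation of `M(tr)`. -/
def aug (p : ℕ) [Fact p.Prime] (k : Type) [Field k] [IsAlgClosed k] [CharZero k] :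
    Mmod p k 1 →ₗ[k] k :=
  liftM (fun _ => 1) (by simp)

lemma aug_apply (g : G p) : aug p k (γ p k g • oneθ p k 1) = 1 := liftM_apply _ _ _

lemma aug_oneθ : aug p k (oneθ p k 1) = 1 := by
  simpa [gamma_one] using aug_apply (k := k) (1 : G p)

lemma aug_St (v : St p k) : aug p k v = 0 := by
  have : aug p k ∘ₗ inclSt p k = 0 := LinearMap.ext_on_range span_E fun x => by
    simp [inclSt_apply, coe_E, aug_apply, aug_oneθ]
  exact LinearMap.congr_fun this v

/-- The invariant form on `M(tr)` for which the translates of `1_tr` are orthonormal. -/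
def form (p : ℕ) [Fact p.Prime] (k : Type) [Field k] [IsAlgClosed k] [CharZero k] :
    Mmod p k 1 →ₗ[k] Mmod p k 1 →ₗ[k] k :=
  liftM (fun g => ell 1 ∘ₗ Algebra.lsmul k k (Mmod p k 1) (γ p k g⁻¹)) (by
    intro g b
    ext m
    have : γ p k (g * b)⁻¹ • m = γ p k ((b⁻¹ : B p) : G p) • γ p k g⁻¹ • m := by
      rw [mul_inv_rev, gamma_mul, mul_smul, Subgroup.coe_inv]
    simp only [LinearMap.comp_apply, LinearMap.smul_apply, Algebra.lsmul_coe]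
    rw [this, ell_smul]
    simp)

lemma form_apply (g : G p) (m : Mmod p k 1) :
    form p k (γ p k g • oneθ p k 1) m = ell 1 (γ p k g⁻¹ • m) := by
  rw [form, liftM_apply]
  rfl

lemma form_oneθ (m : Mmod p k 1) : form p k (oneθ p k 1) m = ell 1 m := by
  simpa [gamma_one] using form_apply (1 : G p) m

lemma form_smul_smul (g : G p) (m m' : Mmod p k 1) :
    form p k (γ p k g • m) (γ p k g • m') = form p k m m' := by
  have : (form p k).compl₁₂ (Algebra.lsmul k k (Mmod p k 1) (γ p k g))
      (Algebra.lsmul k k (Mmod p k 1) (γ p k g)) = form p k := Mmod_hom_ext fun g' => by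
    ext m'
    simp only [LinearMap.compl₁₂_apply, Algebra.lsmul_coe]
    rw [← mul_smul, ← gamma_mul, form_apply, form_apply, ← mul_smul, ← gamma_mul]
    simp
  exact LinearMap.congr_fun₂ this m m'

/-- The invariant form on the Steinberg module. -/
def formSt (p : ℕ) [Fact p.Prime] (k : Type) [Field k] [IsAlgClosed k] [CharZero k] :
    StT p k →ₗ[k] k :=
  TensorProduct.lift ((form p k).compl₁₂ (inclSt p k) (inclSt p k))

lemma formSt_gTT (g : G p) (v : StT p k) : formSt p k (gTT p k g v) = formSt p k v := by
  have : formSt p k ∘ₗ gTT p k g = formSt p k :=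
    TensorProduct.ext' fun v w => form_smul_smul g (v : Mmod p k 1) w
  exact LinearMap.congr_fun this v

lemma formSt_E_zero : formSt p k (E p k 0 ⊗ₜ[k] E p k 0) = 2 := by
  change form p k (E p k 0) (E p k 0) = 2
  have hs : ell 1 (γ p k (sG p)⁻¹ • oneθ p k 1) = 0 :=
    ell_of_notMem fun H => sG_notMem (inv_mem_iff.1 H)
  rw [coe_E, eps_zero, one_mul, LinearMap.map_sub₂, form_oneθ, form_apply, smul_sub,
    ← mul_smul, ← gamma_mul, inv_mul_cancel, gamma_one, one_smul, map_sub, map_sub, hs,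
    ell_of_notMem sG_notMem, ell_oneθ]
  norm_num

lemma exists_unit_sq {x : F p} (hx : x ≠ 0) : ∃ t : (F p)ˣ, (t : F p) ^ 2 = x := by
  obtain ⟨t, ht⟩ := IsAlgClosed.exists_pow_nat_eq x (n := 2) (by norm_num)
  refine ⟨Units.mk0 t ?_, ht⟩
  rintro rfl
  exact hx (by simpa using ht.symm)

lemma apply_E_E_of_eps_invariant {ψ : StT p k →ₗ[k] k}
    (hU : ∀ x v, ψ (gTT p k (eps p x) v) = ψ v) (x y : F p) :
    ψ (E p k x ⊗ₜ[k] E p k y) = ψ (E p k 0 ⊗ₜ[k] E p k (y - x)) := by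
  rw [← hU x (E p k 0 ⊗ₜ[k] E p k (y - x)), gTT_tmul, gSt_eps_E, gSt_eps_E]
  simp

lemma eq_zero_of_invariant {ψ : StT p k →ₗ[k] k} (hψ : ∀ g v, ψ (gTT p k g v) = ψ v)
    (h0 : ψ (E p k 0 ⊗ₜ[k] E p k 0) = 0) : ψ = 0 := by
  refine StT_hom_ext fun x y => ?_
  rw [apply_E_E_of_eps_invariant fun x => hψ (eps p x), LinearMap.zero_apply]
  have hsq : ∀ z, z ≠ 0 → ψ (E p k 0 ⊗ₜ[k] E p k z) = ψ (E p k 0 ⊗ₜ[k] E p k 1) := by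
    intro z hz
    obtain ⟨t, rfl⟩ := exists_unit_sq hz
    rw [← hψ (h p t) (E p k 0 ⊗ₜ[k] E p k 1), gTT_tmul, gSt_h_E, gSt_h_E]
    simp
  have h1 := hψ (sG p)⁻¹ (E p k 0 ⊗ₜ[k] E p k 1)
  rw [gTT_tmul, gSt_sG_inv_E_zero, gSt_sG_inv_E one_ne_zero, ← TensorProduct.smul_tmul',
    TensorProduct.tmul_sub, map_smul, map_sub, smul_eq_mul, h0, sub_zero, hsq _ (by simp)] at h1
  by_cases hxy : y - x = 0
  · rw [hxy, h0]
  · rw [hsq _ hxy]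
    linear_combination (-1 / 2) * h1

lemma gTT_sG_inv_eps {x y : F p} (hx : x ≠ 0) (hxy : x - y ≠ 0) :
    gTT p k ((sG p)⁻¹ * eps p (-x)) (E p k 0 ⊗ₜ[k] E p k y) =
      (E p k x⁻¹ - E p k 0) ⊗ₜ[k] (E p k (x - y)⁻¹ - E p k 0) := by
  have hy : -x + y ≠ 0 := fun H => hxy (by linear_combination -H)
  rw [gTT_mul, gTT_tmul, gTT_tmul, gSt_eps_E, gSt_eps_E, add_zero,
    gSt_sG_inv_E (neg_ne_zero.2 hx), gSt_sG_inv_E hy, ← inv_neg, ← inv_neg]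
  congr 4 <;> ring

/-- A function on `F` with values in characteristic zero, additive up to finitely many exceptions
in each variable, vanishes. -/
lemma eq_zero_of_almost_additive {f : F p → k}
    (hf : ∀ a, {z | f (a + z) ≠ f a + f z}.Finite) (x : F p) : f x = 0 := by
  have hadd : ∀ x y, f (x + y) = f x + f y := by
    intro x y
    obtain ⟨z, hz⟩ := (((hf (x + y)).union (hf y)).union
      ((hf x).preimage (add_right_injective y).injOn)).exists_notMem
    simp only [Set.mem_union, Set.mem_preimage, Set.mem_ofPred_eq, not_or, not_not] at hz
    obtain ⟨⟨h1, h2⟩, h3⟩ := hz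
    rw [add_assoc, h3, h2] at h1
    linear_combination -h1
  have h1 := map_nsmul (AddMonoidHom.mk' f hadd) p x
  have hp : (p : k) ≠ 0 := Nat.cast_ne_zero.2 (Fact.out : p.Prime).ne_zero
  simp only [nsmul_eq_mul, CharP.cast_eq_zero, zero_mul, map_zero, AddMonoidHom.mk'_apply] at h1
  exact (mul_eq_zero.1 h1.symm).resolve_left hp

/-- A `θ`-semi-invariant functional for `B` which vanishes at almost all translates of each vector
is constant on the `E x ⊗ E y`. -/
lemma apply_E_E_eq {θ : (F p)ˣ →* kˣ} {ψ : StT p k →ₗ[k] k}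
    (hU : ∀ x v, ψ (gTT p k (eps p x) v) = ψ v)
    (hT : ∀ t v, ψ (gTT p k (h p t) v) = θ t * ψ v)
    (hfin : ∀ v, {x | ψ (gTT p k ((sG p)⁻¹ * eps p (-x)) v) ≠ 0}.Finite) (x y : F p) :
    ψ (E p k x ⊗ₜ[k] E p k y) = ψ (E p k 0 ⊗ₜ[k] E p k 0) := by
  set f : F p → k := fun z => ψ (E p k 0 ⊗ₜ[k] E p k z) - ψ (E p k 0 ⊗ₜ[k] E p k 0) with hfdef
  have hf0 : f 0 = 0 := by simp [hfdef]
  have hsc : ∀ (t : (F p)ˣ) z, f (t ^ 2 * z) = θ t * f z := by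
    intro t z
    have h1 := hT t (E p k 0 ⊗ₜ[k] E p k z)
    have h2 := hT t (E p k 0 ⊗ₜ[k] E p k 0)
    rw [gTT_tmul, gSt_h_E, gSt_h_E, mul_zero] at h1
    rw [gTT_tmul, gSt_h_E, mul_zero] at h2
    simp only [hfdef]
    linear_combination h1 - h2
  have hadd : ∀ a, {z | f (a + z) ≠ f a + f z}.Finite := by
    intro a
    by_cases ha : a = 0
    · simp [ha, hf0]
    refine (((hfin (E p k 0 ⊗ₜ[k] E p k 1)).image fun x => -a * x / (x - 1)).union
      (Set.toFinite {0, -a})).subset fun z hz => ?_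
    by_contra hn
    simp only [Set.mem_union, Set.mem_image, Set.mem_insert_iff, Set.mem_singleton_iff,
      not_or, not_exists, not_and] at hn
    obtain ⟨hn, hz0, hza⟩ := hn
    have hza' : z + a ≠ 0 := fun H => hza (eq_neg_of_add_eq_zero_left H)
    set x := z / (z + a) with hx
    have hx0 : x ≠ 0 := div_ne_zero hz0 hza'
    have hx1' : x - 1 = -a / (z + a) := by rw [hx]; field_simp; ring
    have hx1 : x - 1 ≠ 0 := by rw [hx1']; exact div_ne_zero (neg_ne_zero.2 ha) hza'
    have hxz : -a * x / (x - 1) = z := by rw [hx1', hx]; field_simp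
    have hbad : ψ (gTT p k ((sG p)⁻¹ * eps p (-x)) (E p k 0 ⊗ₜ[k] E p k 1)) = 0 := by
      by_contra H
      exact hn x H hxz
    rw [gTT_sG_inv_eps hx0 hx1, TensorProduct.sub_tmul, TensorProduct.tmul_sub,
      TensorProduct.tmul_sub, map_sub, map_sub, map_sub, apply_E_E_of_eps_invariant hU x⁻¹,
      apply_E_E_of_eps_invariant hU x⁻¹, zero_sub] at hbad
    have hf1 : f (-x⁻¹ + (x - 1)⁻¹) = f (-x⁻¹) + f (x - 1)⁻¹ := by
      rw [neg_add_eq_sub]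
      simp only [hfdef]
      linear_combination hbad
    obtain ⟨t, ht⟩ := exists_unit_sq (x := -a * x) (mul_ne_zero (neg_ne_zero.2 ha) hx0)
    have e1 : a = t ^ 2 * -x⁻¹ := by rw [ht]; field_simp
    have e2 : z = t ^ 2 * (x - 1)⁻¹ := by rw [ht, ← div_eq_mul_inv, hxz]
    apply hz
    rw [e1, e2, ← mul_add, hsc, hsc, hsc, hf1, mul_add]
  rw [apply_E_E_of_eps_invariant hU]
  exact sub_eq_zero.1 (eq_zero_of_almost_additive hadd (y - x))

variable {θ : (F p)ˣ →* kˣ} {φ : StT p k →ₗ[k] Mmod p k θ}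

lemma ell_apply_E_E (hφ : ∀ g v, φ (gTT p k g v) = γ p k g • φ v) (x y : F p) :
    ell θ (φ (E p k x ⊗ₜ[k] E p k y)) = ell θ (φ (E p k 0 ⊗ₜ[k] E p k 0)) :=
  apply_E_E_eq (θ := θ) (ψ := ell θ ∘ₗ φ)
    (fun x v => by rw [LinearMap.comp_apply, hφ, ell_eps, LinearMap.comp_apply])
    (fun t v => by rw [LinearMap.comp_apply, hφ, ell_h, LinearMap.comp_apply])
    (fun v => by
      simp only [LinearMap.comp_apply, hφ]
      exact finite_ell_ne_zero (φ v)) x y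

lemma eq_zero_of_ell_apply (hφ : ∀ g v, φ (gTT p k g v) = γ p k g • φ v)
    (h0 : ell θ (φ (E p k 0 ⊗ₜ[k] E p k 0)) = 0) : φ = 0 := by
  have hψ : ell θ ∘ₗ φ = 0 := StT_hom_ext fun x y => by
    rw [LinearMap.comp_apply, ell_apply_E_E hφ, h0, LinearMap.zero_apply]
  refine LinearMap.ext fun v => ?_
  refine eq_zero_of_ell_eq_zero fun g => ?_
  rw [← hφ]
  exact LinearMap.congr_fun hψ _

lemma eq_zero_of_ne_one (hθ : θ ≠ 1) (hφ : ∀ g v, φ (gTT p k g v) = γ p k g • φ v) :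
    φ = 0 := by
  refine eq_zero_of_ell_apply hφ ?_
  obtain ⟨t, ht⟩ : ∃ t, θ t ≠ 1 := by
    by_contra! H
    exact hθ (MonoidHom.ext H)
  have h1 := ell_h t (φ (E p k 0 ⊗ₜ[k] E p k 0))
  rw [← hφ, gTT_tmul, gSt_h_E, mul_zero] at h1
  have h2 : (θ t : k) - 1 ≠ 0 := fun H => ht (Units.ext (sub_eq_zero.1 H))
  refine (mul_eq_zero.1 ?_).resolve_left h2
  linear_combination -h1

lemma eq_zero_of_aug {φ : StT p k →ₗ[k] Mmod p k 1}
    (hφ : ∀ g v, φ (gTT p k g v) = γ p k g • φ v) (haug : ∀ v, aug p k (φ v) = 0) : φ = 0 := by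
  refine eq_zero_of_ell_apply hφ ?_
  obtain ⟨c, hc, hm⟩ := exists_expansion_ell (φ (E p k 0 ⊗ₜ[k] E p k 0))
  have hconst := ell_apply_E_E hφ
  set r := ell 1 (φ (E p k 0 ⊗ₜ[k] E p k 0))
  have hcs : c = Finsupp.single 0 r := by
    ext x
    rw [hc, ← hφ]
    by_cases hx : x = 0
    · rw [hx, neg_zero, eps_zero, mul_one, gTT_tmul, gSt_sG_inv_E_zero, TensorProduct.smul_tmul_smul,
        neg_one_mul, neg_neg, one_smul, Finsupp.single_eq_same]
    · rw [gTT_sG_inv_eps hx (by simpa using hx), TensorProduct.sub_tmul, TensorProduct.tmul_sub,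
        TensorProduct.tmul_sub]
      simp [hconst, hx]
  have h1 := haug (E p k 0 ⊗ₜ[k] E p k 0)
  rw [hm, hcs, Finsupp.sum_single_index (by simp), map_add, map_smul, map_smul, aug_oneθ,
    aug_apply, smul_eq_mul] at h1
  linear_combination h1 / 2

end Steinberg

end Auxiliary

/-- `dim_k Hom_{kG}(St ⊗ St, k_tr) = 1`, `Hom_{kG}(St ⊗ St, St) = 0`
and `Hom_{kG}(St ⊗ St, M(θ)) = 0` for every nontrivial `θ`; in particular the
maximal semisimple quotient of `St ⊗ St` in the category is the trivial module. -/
theorem stmt17 (hp2 : p ≠ 2) :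
    (∃ φ₀ : StT p k →ₗ[k] k,
      (∀ (g : G p) (v : StT p k), φ₀ (gTT p k g v) = φ₀ v) ∧ φ₀ ≠ 0 ∧
      ∀ φ : StT p k →ₗ[k] k,
        (∀ (g : G p) (v : StT p k), φ (gTT p k g v) = φ v) → ∃ c : k, φ = c • φ₀) ∧
    (∀ φ : StT p k →ₗ[k] ↥(St p k),
      (∀ (g : G p) (v : StT p k), φ (gTT p k g v) = gSt p k g (φ v)) → φ = 0) ∧
    (∀ θ : (F p)ˣ →* kˣ, θ ≠ 1 →
      ∀ φ : StT p k →ₗ[k] Mmod p k θ,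
        (∀ (g : G p) (v : StT p k), φ (gTT p k g v) = γ p k g • φ v) → φ = 0) := by
  refine ⟨⟨formSt p k, formSt_gTT, fun H => ?_, fun φ hφ => ?_⟩, fun φ hφ => ?_,
    fun θ hθ φ hφ => eq_zero_of_ne_one hθ hφ⟩
  · have h2 := formSt_E_zero (p := p) (k := k)
    rw [H, LinearMap.zero_apply] at h2
    exact two_ne_zero h2.symm
  · refine ⟨φ (E p k 0 ⊗ₜ[k] E p k 0) / 2, sub_eq_zero.1 (eq_zero_of_invariant ?_ ?_)⟩
    · intro g v
      simp [hφ, formSt_gTT]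
    · simp [formSt_E_zero]
  · have h0 : inclSt p k ∘ₗ φ = 0 := eq_zero_of_aug
      (fun g v => by rw [LinearMap.comp_apply, hφ]; rfl) (fun v => aug_St (φ v))
    exact LinearMap.ext fun v => inclSt_injective (LinearMap.congr_fun h0 v)

end SL2X
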